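/- Let A > 0, C > 0, c̃ > 0, γ ∈ ℝ \ {0,1}, P ∈ ℝ^K with all p_k > 0 and M_P := Σ_k p_k, and Q ∈ M̃_γ, where M̃_γ := A·𝕊^K_{>0} for γ < 0 and M̃_γ := A·𝕊^K for γ > 0. Then, in the subsetup Q** := C·P, inf_{m≠0} D^{SBD}_{c̃·φ_γ,P}(m·Q, C·P) = (c̃·C^γ/γ)·( M_P − A^{γ/(γ−1)}·[ C^γ·M_P + γ·C^{γ−1}·(A − C·M_P) + γ·(γ−1)·D^{SBD}_{c̃·φ_γ,P}(Q, C·P)/c̃ ]^{−1/(γ−1)} ). -/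

import Mathlib

open scoped BigOperators ENNReal Pointwise

noncomputable section

namespace BareSim

/-- The positive part `𝕊^K_{>0}` of the probability simplex. -/
def stdSimplexPos (K : ℕ) : Set (Fin K → ℝ) := {Q | (∀ k, 0 < Q k) ∧ ∑ k, Q k = 1}

/-- The power-divergence generator `φ_γ : ℝ → [0,∞]` for `γ ∈ ℝ \ {0,1}`:
`φ_γ(t) = (t^γ − γ·t + γ − 1)/(γ·(γ−1))` for `t > 0` (with `φ_γ(0) = 1/γ` for `γ > 0`,
using `0^γ := 0`), `φ_γ(t) = 1/γ − t/(γ−1)` for `t ≤ 0` if `γ > 1`, and `+∞`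
otherwise. -/
def phiGamE (γ t : ℝ) : ℝ≥0∞ :=
  if 0 < t then ENNReal.ofReal ((t ^ γ - γ * t + γ - 1) / (γ * (γ - 1)))
  else if 1 < γ then ENNReal.ofReal (1 / γ - t / (γ - 1))
  else if 0 < γ ∧ t = 0 then ENNReal.ofReal (1 / γ)
  else ⊤

/-- The derivative `φ_γ'(t) = (t^{γ−1} − 1)/(γ−1)` of `φ_γ` (for `t > 0`). -/
def dphiGamR (γ t : ℝ) : ℝ := (t ^ (γ - 1) - 1) / (γ - 1)

/-- The scaled Bregman distance `D^{SBD}_{c̃·φ_γ,P}(Q,Q**)` with generator `c̃·φ_γ`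
and scaling vector `P` (components of `P` and `Q**` strictly positive). -/
def DSBDg (K : ℕ) (γ c : ℝ) (p Qs Q : Fin K → ℝ) : EReal :=
  ((c : ℝ) : EReal) * ∑ k, ((p k : ℝ) : EReal) *
    ((phiGamE γ (Q k / p k) : EReal) - (phiGamE γ (Qs k / p k) : EReal)
      - ((dphiGamR γ (Qs k / p k) * (Q k / p k - Qs k / p k) : ℝ) : EReal))

/-- The modified `γ`-order Hellinger integral `H_γ(Q,P) = Σ_k q_k^γ·p_k^{1−γ}`. -/
def Hgam (K : ℕ) (γ : ℝ) (Q p : Fin K → ℝ) : ℝ := ∑ k, Q k ^ γ * p k ^ (1 - γ)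

/-- The `γ`-order triple power sum `T_γ(Q,Q**,P) = Σ_k q_k·(q**_k)^{γ−1}·p_k^{1−γ}`. -/
def Tgam (K : ℕ) (γ : ℝ) (Q Qs p : Fin K → ℝ) : ℝ :=
  ∑ k, Q k * Qs k ^ (γ - 1) * p k ^ (1 - γ)

lemma coe_sum_ereal {ι : Type*} (s : Finset ι) (f : ι → ℝ) :
    ((∑ i ∈ s, f i : ℝ) : EReal) = ∑ i ∈ s, (f i : EReal) := by
  classical
  induction s using Finset.induction_on with
  | empty => simp
  | insert a s ha ih => rw [Finset.sum_insert ha, Finset.sum_insert ha, EReal.coe_add, ih]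

lemma sum_eq_top_of_ne_bot {ι : Type*} {s : Finset ι} {f : ι → EReal} {i : ι} (hi : i ∈ s)
    (htop : f i = ⊤) (hbot : ∀ j ∈ s, f j ≠ ⊥) : ∑ j ∈ s, f j = ⊤ := by
  classical
  rw [← Finset.add_sum_erase s f hi, htop]
  refine EReal.top_add_of_ne_bot (Finset.sum_induction f (· ≠ ⊥) ?_ EReal.zero_ne_bot ?_)
  · exact fun a b ha hb => EReal.add_ne_bot_iff.2 ⟨ha, hb⟩
  · exact fun j hj => hbot j (Finset.mem_of_mem_erase hj)

/-- Bernoulli's inequality for real exponents, in the form `0 ≤ φ_γ(t)`. -/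
lemma powerDivergence_nonneg {γ t : ℝ} (hγ0 : γ ≠ 0) (hγ1 : γ ≠ 1) (ht : 0 < t) :
    0 ≤ (t ^ γ - γ * t + γ - 1) / (γ * (γ - 1)) := by
  have ht1 : -1 ≤ t - 1 := by linarith
  have hadd : 1 + (t - 1) = t := by ring
  rcases lt_or_gt_of_ne hγ0 with h | h
  · refine div_nonneg ?_ (mul_nonneg_of_nonpos_of_nonpos h.le (by linarith))
    rw [Real.rpow_def_of_pos ht]
    have h1 := Real.add_one_le_exp (Real.log t * γ)
    have h2 := Real.log_le_sub_one_of_pos ht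
    nlinarith
  · rcases lt_or_gt_of_ne hγ1 with h' | h'
    · refine div_nonneg_of_nonpos ?_ (mul_nonpos_of_nonneg_of_nonpos h.le (by linarith))
      have := rpow_one_add_le_one_add_mul_self ht1 h.le h'.le
      rw [hadd] at this
      linarith
    · refine div_nonneg ?_ (mul_nonneg h.le (by linarith))
      have := one_add_mul_self_le_rpow_one_add ht1 h'.le
      rw [hadd] at this
      linarith

/-- On its effective domain, `φ_γ` is given by a single formula in the positive part of `t`. -/
lemma coe_phiGamE {γ t : ℝ} (hγ0 : γ ≠ 0) (hγ1 : γ ≠ 1)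
    (ht : 0 < t ∨ 1 < γ ∨ (0 < γ ∧ t = 0)) :
    (phiGamE γ t : EReal)
      = (((max t 0 ^ γ - γ * t + γ - 1) / (γ * (γ - 1)) : ℝ) : EReal) := by
  have hγ1' : γ - 1 ≠ 0 := sub_ne_zero.2 hγ1
  unfold phiGamE
  split_ifs with h1 h2 h3
  · rw [EReal.coe_ennreal_ofReal, max_eq_left h1.le,
      max_eq_left (powerDivergence_nonneg hγ0 hγ1 h1)]
  · have hnonneg : 0 ≤ 1 / γ - t / (γ - 1) := by
      have h4 : 0 ≤ 1 / γ := by positivity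
      have h5 : t / (γ - 1) ≤ 0 := div_nonpos_of_nonpos_of_nonneg (by linarith) (by linarith)
      linarith
    rw [EReal.coe_ennreal_ofReal, max_eq_left hnonneg, max_eq_right (not_lt.1 h1),
      Real.zero_rpow hγ0]
    congr 1
    field_simp
    ring
  · obtain ⟨h3, rfl⟩ := h3
    rw [EReal.coe_ennreal_ofReal, max_eq_left (by positivity), max_self, Real.zero_rpow hγ0]
    congr 1
    field_simp
    ring
  · tauto

section

variable {K : ℕ} {C c γ : ℝ} {p R : Fin K → ℝ}

lemma smul_apply_div_self (hp : ∀ k, 0 < p k) (k : Fin K) : (C • p) k / p k = C := by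
  simp [(hp k).ne']

lemma DSBDg_smul_eq_coe (hC : 0 < C) (hγ0 : γ ≠ 0) (hγ1 : γ ≠ 1) (hp : ∀ k, 0 < p k)
    (hR : ∀ k, 0 < R k ∨ 1 < γ ∨ (0 < γ ∧ R k = 0)) :
    DSBDg K γ c p (C • p) R = ((c / (γ * (γ - 1)) * ((∑ k, p k * max (R k / p k) 0 ^ γ)
      - C ^ γ * (∑ k, p k) - γ * C ^ (γ - 1) * ((∑ k, R k) - C * ∑ k, p k)) : ℝ) : EReal) := by
  have hγ1' : γ - 1 ≠ 0 := sub_ne_zero.2 hγ1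
  have hterm : ∀ k, ((p k : ℝ) : EReal) *
      ((phiGamE γ (R k / p k) : EReal) - (phiGamE γ ((C • p) k / p k) : EReal)
        - ((dphiGamR γ ((C • p) k / p k) * (R k / p k - (C • p) k / p k) : ℝ) : EReal))
      = (((p k * max (R k / p k) 0 ^ γ - C ^ γ * p k
          - γ * C ^ (γ - 1) * (R k - C * p k)) / (γ * (γ - 1)) : ℝ) : EReal) := by
    intro k
    have hpk := (hp k).ne'
    have hdom : 0 < R k / p k ∨ 1 < γ ∨ (0 < γ ∧ R k / p k = 0) := by
      rcases hR k with h | h | ⟨h, h'⟩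
      · exact Or.inl (div_pos h (hp k))
      · exact Or.inr (Or.inl h)
      · exact Or.inr (Or.inr ⟨h, by simp [h']⟩)
    rw [smul_apply_div_self hp, coe_phiGamE hγ0 hγ1 hdom, coe_phiGamE hγ0 hγ1 (Or.inl hC),
      max_eq_left hC.le, dphiGamR, ← EReal.coe_sub, ← EReal.coe_sub, ← EReal.coe_mul]
    congr 1
    generalize max (R k / p k) 0 ^ γ = x
    field_simp
    ring
  rw [DSBDg, Finset.sum_congr rfl fun k _ => hterm k, ← coe_sum_ereal, ← EReal.coe_mul,
    ← Finset.sum_div]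
  simp only [Finset.sum_sub_distrib, ← Finset.mul_sum]
  congr 1
  ring

lemma DSBDg_smul_eq_top (hC : 0 < C) (hc : 0 < c) (hγ0 : γ ≠ 0) (hγ1 : γ < 1)
    (hp : ∀ k, 0 < p k) {k : Fin K} (hk : R k < 0) : DSBDg K γ c p (C • p) R = ⊤ := by
  have hcoe := coe_phiGamE (t := C) hγ0 hγ1.ne (Or.inl hC)
  have hlt : R k / p k < 0 := div_neg_of_neg_of_pos hk (hp k)
  have htop : phiGamE γ (R k / p k) = ⊤ := by
    simp [phiGamE, hlt.not_gt, hγ1.not_gt, hlt.ne]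
  have hsum := sum_eq_top_of_ne_bot (f := fun k => ((p k : ℝ) : EReal) *
    ((phiGamE γ (R k / p k) : EReal) - (phiGamE γ ((C • p) k / p k) : EReal)
      - ((dphiGamR γ ((C • p) k / p k) * (R k / p k - (C • p) k / p k) : ℝ) : EReal)))
    (Finset.mem_univ k) ?_ ?_
  · rw [DSBDg, hsum, EReal.coe_mul_top_of_pos hc]
  · simp only [smul_apply_div_self hp]
    rw [hcoe, htop, EReal.coe_ennreal_top, EReal.top_sub_coe, EReal.top_sub_coe,
      EReal.coe_mul_top_of_pos (hp k)]
  · intro j _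
    simp only [smul_apply_div_self hp]
    rw [hcoe]
    by_cases hj : phiGamE γ (R j / p j) = ⊤
    · rw [hj, EReal.coe_ennreal_top, EReal.top_sub_coe, EReal.top_sub_coe,
        EReal.coe_mul_top_of_pos (hp j)]
      exact top_ne_bot
    · lift phiGamE γ (R j / p j) to NNReal using hj with x
      rw [EReal.coe_nnreal_eq_coe_real, ← EReal.coe_sub, ← EReal.coe_sub, ← EReal.coe_mul]
      exact EReal.coe_ne_bot _

end

/-- Theorem `brostu5:thm.divnormW.new.SBD`(a), subsetup `Q** = C·P`:
`inf_{m≠0} D^{SBD}_{c̃·φ_γ,P}(m·Q, C·P)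
  = (c̃·C^γ/γ)·( M_P − A^{γ/(γ−1)}·[C^γ·M_P + γ·C^{γ−1}·(A − C·M_P)
      + γ·(γ−1)·D^{SBD}_{c̃·φ_γ,P}(Q, C·P)/c̃]^{−1/(γ−1)} )`. -/
theorem statement15
    (K : ℕ) (A C c γ : ℝ) (hA : 0 < A) (hC : 0 < C) (hc : 0 < c)
    (hγ0 : γ ≠ 0) (hγ1 : γ ≠ 1)
    (p : Fin K → ℝ) (hp : ∀ k, 0 < p k)
    (Q : Fin K → ℝ)
    (hQneg : γ < 0 → Q ∈ A • stdSimplexPos K)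
    (hQpos : 0 < γ → Q ∈ A • stdSimplex ℝ (Fin K)) :
    (⨅ (m : ℝ) (_ : m ≠ 0), DSBDg K γ c p (C • p) (m • Q))
      = ((c * C ^ γ / γ * ((∑ k, p k)
          - A ^ (γ / (γ - 1)) *
            (C ^ γ * (∑ k, p k) + γ * C ^ (γ - 1) * (A - C * (∑ k, p k))
              + γ * (γ - 1) * (DSBDg K γ c p (C • p) Q).toReal / c)
              ^ (-1 / (γ - 1))) : ℝ) : EReal) := by
  have hγ1' : γ - 1 ≠ 0 := sub_ne_zero.2 hγ1
  have hQ : ∀ k, 0 < Q k ∨ (0 < γ ∧ Q k = 0) := by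
    intro k
    rcases lt_or_gt_of_ne hγ0 with h | h
    · obtain ⟨S, hS, rfl⟩ := hQneg h
      exact Or.inl (mul_pos hA (hS.1 k))
    · obtain ⟨S, hS, rfl⟩ := hQpos h
      rcases (hS.1 k).eq_or_lt with h' | h'
      · exact Or.inr ⟨h, by simp [← h']⟩
      · exact Or.inl (mul_pos hA h')
  have hQsum : ∑ k, Q k = A := by
    rcases lt_or_gt_of_ne hγ0 with h | h
    · obtain ⟨S, hS, rfl⟩ := hQneg h
      simp [← Finset.mul_sum, hS.2]
    · obtain ⟨S, hS, rfl⟩ := hQpos h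
      simp [← Finset.mul_sum, hS.2]
  have hQ0 : ∀ k, 0 ≤ Q k := fun k => (hQ k).elim le_of_lt fun h => h.2.ge
  obtain ⟨j, -, hj⟩ : ∃ j ∈ Finset.univ, 0 < Q j :=
    Finset.exists_lt_of_sum_lt (f := fun _ => (0 : ℝ)) (by simpa [hQsum] using hA)
  set M := ∑ k, p k with hM
  have hM0 : 0 ≤ M := Finset.sum_nonneg fun k _ => (hp k).le
  set H := ∑ k, p k * (Q k / p k) ^ γ with hH
  have hH0 : 0 < H :=
    Finset.sum_pos' (fun k _ => mul_nonneg (hp k).le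
        (Real.rpow_nonneg (div_nonneg (hQ0 k) (hp k).le) γ))
      ⟨j, Finset.mem_univ j, mul_pos (hp j) (Real.rpow_pos_of_pos (div_pos hj (hp j)) γ)⟩
  have hpos : ∀ m, 0 < m → DSBDg K γ c p (C • p) (m • Q) = ((c / (γ * (γ - 1)) *
      (m ^ γ * H - C ^ γ * M - γ * C ^ (γ - 1) * (m * A - C * M)) : ℝ) : EReal) := by
    intro m hm
    rw [DSBDg_smul_eq_coe hC hγ0 hγ1 hp]
    · simp only [Pi.smul_apply, smul_eq_mul, ← Finset.mul_sum, hQsum]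
      have hsum : ∑ k, p k * max (m * Q k / p k) 0 ^ γ = m ^ γ * H := by
        rw [hH, Finset.mul_sum]
        refine Finset.sum_congr rfl fun k _ => ?_
        have hdiv := div_nonneg (hQ0 k) (hp k).le
        rw [mul_div_assoc, max_eq_left (mul_nonneg hm.le hdiv), Real.mul_rpow hm.le hdiv]
        ring
      rw [hsum]
    · intro k
      rcases hQ k with h | ⟨h, h'⟩
      · exact Or.inl (mul_pos hm h)
      · exact Or.inr (Or.inr ⟨h, by simp [h']⟩)
  have hbracket : C ^ γ * M + γ * C ^ (γ - 1) * (A - C * M)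
      + γ * (γ - 1) * (DSBDg K γ c p (C • p) Q).toReal / c = H := by
    have h1 := hpos 1 one_pos
    rw [one_smul] at h1
    rw [h1, EReal.toReal_coe, Real.one_rpow]
    field_simp
    ring
  rw [hbracket]
  -- the stationary point of `m ↦ D(m • Q, C • P)` on `(0, ∞)`
  set m₀ := C * (A / H) ^ (1 / (γ - 1)) with hm₀
  have hm₀pos : 0 < m₀ := mul_pos hC (Real.rpow_pos_of_pos (div_pos hA hH0) _)
  have hCγ : C ^ γ = C ^ (γ - 1) * C := by
    rw [← Real.rpow_add_one hC.ne', sub_add_cancel]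
  have hCpos : 0 < C ^ (γ - 1) := Real.rpow_pos_of_pos hC _
  have hstat : m₀ ^ γ * H = C ^ (γ - 1) * A * m₀ := by
    have h1 : m₀ ^ (γ - 1) = C ^ (γ - 1) * (A / H) := by
      rw [hm₀, Real.mul_rpow hC.le (by positivity), ← Real.rpow_mul (by positivity),
        one_div_mul_cancel hγ1', Real.rpow_one]
    have h2 : m₀ ^ γ = m₀ ^ (γ - 1) * m₀ := by
      rw [← Real.rpow_add_one hm₀pos.ne', sub_add_cancel]
    rw [h2, h1]
    field_simp
  have hvalue : C * (A ^ (γ / (γ - 1)) * H ^ (-1 / (γ - 1))) = A * m₀ := by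
    have h1 : γ / (γ - 1) = 1 / (γ - 1) + 1 := by field_simp; ring
    rw [hm₀, Real.div_rpow hA.le hH0.le, h1, Real.rpow_add_one hA.ne', neg_div,
      Real.rpow_neg hH0.le]
    ring
  have htarget : c * C ^ γ / γ * (M - A ^ (γ / (γ - 1)) * H ^ (-1 / (γ - 1)))
      = c * C ^ (γ - 1) / γ * (C * M - A * m₀) := by
    rw [← hvalue, hCγ]
    ring
  rw [htarget]
  refine le_antisymm (iInf₂_le_of_le m₀ hm₀pos.ne' ?_) (le_iInf₂ fun m hm => ?_)
  · rw [hpos m₀ hm₀pos, hstat, hCγ]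
    refine (congrArg _ ?_).le
    field_simp
    ring
  rcases lt_or_gt_of_ne hm with hm | hm
  · rcases lt_or_gt_of_ne hγ1 with h | h
    · rw [DSBDg_smul_eq_top hC hc hγ0 h hp (k := j) (mul_neg_of_neg_of_pos hm hj)]
      exact le_top
    · have hγpos : 0 < γ := by linarith
      have hγ1pos : 0 < γ - 1 := by linarith
      rw [DSBDg_smul_eq_coe hC hγ0 hγ1 hp fun k => Or.inr (Or.inl h)]
      simp only [Pi.smul_apply, smul_eq_mul, ← Finset.mul_sum, hQsum]
      have hzero : ∑ k, p k * max (m * Q k / p k) 0 ^ γ = 0 :=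
        Finset.sum_eq_zero fun k _ => by
          rw [max_eq_right (div_nonpos_of_nonpos_of_nonneg
            (mul_nonpos_of_nonpos_of_nonneg hm.le (hQ0 k)) (hp k).le), Real.zero_rpow hγ0,
            mul_zero]
      rw [hzero, EReal.coe_le_coe_iff, ← sub_nonneg]
      have hdiff : c / (γ * (γ - 1)) * (0 - C ^ γ * M - γ * C ^ (γ - 1) * (m * A - C * M))
          - c * C ^ (γ - 1) / γ * (C * M - A * m₀)
          = c * C ^ (γ - 1) * A * (m₀ / γ + (-m) / (γ - 1)) := by
        rw [hCγ]
        field_simp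
        ring
      rw [hdiff]
      have hm' : 0 < -m := neg_pos.2 hm
      positivity
  · rw [hpos m hm, EReal.coe_le_coe_iff, ← sub_nonneg]
    have hs : m ^ γ * H = (m / m₀) ^ γ * (C ^ (γ - 1) * A * m₀) := by
      rw [← hstat, Real.div_rpow hm.le hm₀pos.le]
      have := (Real.rpow_pos_of_pos hm₀pos γ).ne'
      field_simp
    have hdiff : c / (γ * (γ - 1)) * (m ^ γ * H - C ^ γ * M - γ * C ^ (γ - 1) * (m * A - C * M))
        - c * C ^ (γ - 1) / γ * (C * M - A * m₀)
        = c * C ^ (γ - 1) * A * m₀ *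
          (((m / m₀) ^ γ - γ * (m / m₀) + γ - 1) / (γ * (γ - 1))) := by
      rw [hs, hCγ]
      generalize (m / m₀) ^ γ = x
      field_simp
      ring
    rw [hdiff]
    exact mul_nonneg (by positivity) (powerDivergence_nonneg hγ0 hγ1 (div_pos hm hm₀pos))

end BareSim
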